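/- A continuous function f : ℝ → M into a complete metric space (M,d) is Bohr almost periodic if and only if for every pair of sequences (α'_n) and (β'_n) of real numbers there exist common subsequences (α_k = α'_{n_k}) and (β_k = β'_{n_k}) (extracted along the same index sequence n_k) such that for every t ∈ ℝ: the limit h(t) := lim_{k→∞} f(t + α_k + β_k) exists, the limit g(t) := lim_{k→∞} f(t + β_k) exists, the limit lim_{k→∞} g(t + α_k) exists, and lim_{k→∞} g(t + α_k) = h(t). -/

import Mathlib

open Filter Topology Set

/-- A set `T ⊆ ℝ` is relatively dense if there is `l > 0` such that every open
interval `(a, a+l)` contains a point of `T`. -/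
def RelativelyDense (T : Set ℝ) : Prop :=
  ∃ l > 0, ∀ a : ℝ, ∃ τ ∈ Set.Ioo a (a + l), τ ∈ T

/-- `f : ℝ → M` is Bohr almost periodic: for every `ε > 0`,
the set of `ε`-almost periods of `f` is relatively dense in `ℝ`. -/
def IsBohrAP {M : Type*} [PseudoMetricSpace M] (f : ℝ → M) : Prop :=
  ∀ ε > 0, RelativelyDense {τ : ℝ | ∀ t : ℝ, dist (f (t + τ)) (f t) < ε}

lemma IsBohrAP.unifCont {M : Type*} [MetricSpace M] {f : ℝ → M} (hf : Continuous f)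
    (h : IsBohrAP f) : UniformContinuous f := by
  rw [Metric.uniformContinuous_iff]
  intro ε hε
  obtain ⟨l, hl, H⟩ := h (ε / 3) (by positivity)
  have huc : UniformContinuousOn f (Icc (-1) (l + 1)) :=
    isCompact_Icc.uniformContinuousOn_of_continuous hf.continuousOn
  rw [Metric.uniformContinuousOn_iff] at huc
  obtain ⟨δ, hδ, hd⟩ := huc (ε / 3) (by positivity)
  refine ⟨min δ 1, by positivity, ?_⟩
  intro t u htu
  obtain ⟨τ, ⟨h1, h2⟩, hτ⟩ := H (-t)
  have hd1 : dist t u < δ := lt_of_lt_of_le htu (min_le_left _ _)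
  have hd2 : dist t u < 1 := lt_of_lt_of_le htu (min_le_right _ _)
  rw [Real.dist_eq, abs_lt] at hd2
  have a1 := hτ t
  have a2 := hτ u
  have a3 := hd (t + τ) ⟨by linarith, by linarith⟩ (u + τ) ⟨by linarith, by linarith⟩
    (by simpa using hd1)
  have a4 := dist_triangle4 (f t) (f (t + τ)) (f (u + τ)) (f u)
  rw [dist_comm (f t) (f (t + τ))] at a4
  linarith

lemma IsBohrAP.net {M : Type*} [MetricSpace M] {f : ℝ → M} (hf : Continuous f)
    (h : IsBohrAP f) (ε : ℝ) (hε : 0 < ε) :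
    ∃ s : Set ℝ, s.Finite ∧ ∀ a, ∃ x ∈ s, ∀ t, dist (f (t + a)) (f (t + x)) < ε := by
  have huc := h.unifCont hf
  rw [Metric.uniformContinuous_iff] at huc
  obtain ⟨δ, hδ, hd⟩ := huc (ε / 2) (by positivity)
  obtain ⟨l, hl, H⟩ := h (ε / 2) (by positivity)
  obtain ⟨s, hs, hcov⟩ := Metric.totallyBounded_iff.1
    (isCompact_Icc (a := (0 : ℝ)) (b := l)).totallyBounded δ hδ
  refine ⟨s, hs, fun a => ?_⟩
  obtain ⟨τ, ⟨h1, h2⟩, hτ⟩ := H (a - l)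
  have hm := hcov (show a - τ ∈ Icc 0 l from ⟨by linarith, by linarith⟩)
  simp only [mem_iUnion, Metric.mem_ball] at hm
  obtain ⟨x, hx, hxd⟩ := hm
  refine ⟨x, hx, fun t => ?_⟩
  have a1 := hτ (t + (a - τ))
  rw [show t + (a - τ) + τ = t + a by ring] at a1
  have a2 := @hd (t + (a - τ)) (t + x) (by simpa using hxd)
  have a3 := dist_triangle (f (t + a)) (f (t + (a - τ))) (f (t + x))
  linarith

/-- Every sequence of translates has a uniformly convergent subsequence. -/
lemma IsBohrAP.subseq {M : Type*} [MetricSpace M] [CompleteSpace M] {f : ℝ → M}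
    (hf : Continuous f) (h : IsBohrAP f) (α : ℕ → ℝ) :
    ∃ φ : ℕ → ℕ, StrictMono φ ∧ ∃ g : ℝ → M,
      TendstoUniformly (fun k t => f (t + α (φ k))) g atTop := by
  have hb : Bornology.IsBounded (range f) := by
    apply TotallyBounded.isBounded
    rw [Metric.totallyBounded_iff]
    intro ε hε
    obtain ⟨s, hs, H⟩ := h.net hf ε hε
    refine ⟨f '' s, hs.image f, ?_⟩
    rintro _ ⟨a, rfl⟩
    obtain ⟨x, hx, hxd⟩ := H a
    simp only [mem_iUnion, Metric.mem_ball]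
    exact ⟨f x, ⟨x, hx, rfl⟩, by simpa using hxd 0⟩
  obtain ⟨C, hC⟩ := Metric.isBounded_iff.1 hb
  let F : ℝ → BoundedContinuousFunction ℝ M := fun a =>
    BoundedContinuousFunction.mkOfBound ⟨fun t => f (t + a), by fun_prop⟩ C
      (fun x y => hC ⟨_, rfl⟩ ⟨_, rfl⟩)
  have htb : TotallyBounded (range F) := by
    rw [Metric.totallyBounded_iff]
    intro ε hε
    obtain ⟨s, hs, H⟩ := h.net hf (ε / 2) (by positivity)
    refine ⟨F '' s, hs.image F, ?_⟩
    rintro _ ⟨a, rfl⟩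
    obtain ⟨x, hx, hxd⟩ := H a
    simp only [mem_iUnion, Metric.mem_ball]
    refine ⟨F x, ⟨x, hx, rfl⟩, lt_of_le_of_lt ?_ (half_lt_self hε)⟩
    rw [BoundedContinuousFunction.dist_le (by positivity)]
    exact fun t => (hxd t).le
  have hc : IsCompact (closure (range F)) :=
    htb.closure.isCompact_of_isClosed isClosed_closure
  obtain ⟨G, -, φ, hφ, hG⟩ := hc.tendsto_subseq (x := fun n => F (α n))
    (fun n => subset_closure ⟨_, rfl⟩)
  exact ⟨φ, hφ, G, BoundedContinuousFunction.tendsto_iff_tendstoUniformly.1 hG⟩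

theorem bohrAP_iff_pointwise_double_seq {M : Type*} [MetricSpace M] [CompleteSpace M]
    (f : ℝ → M) (hf : Continuous f) :
    IsBohrAP f ↔
      ∀ α' β' : ℕ → ℝ, ∃ φ : ℕ → ℕ, StrictMono φ ∧
        ∃ h g : ℝ → M,
          (∀ t : ℝ, Tendsto (fun k => f (t + (α' (φ k) + β' (φ k)))) atTop (nhds (h t))) ∧
          (∀ t : ℝ, Tendsto (fun k => f (t + β' (φ k))) atTop (nhds (g t))) ∧
          (∀ t : ℝ, Tendsto (fun k => g (t + α' (φ k))) atTop (nhds (h t))) := by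
  constructor
  · intro H α β
    obtain ⟨φ, hφ, g, hg⟩ := H.subseq hf β
    obtain ⟨ψ, hψ, h, hh⟩ := H.subseq hf (fun n => α (φ n) + β (φ n))
    have h1 : ∀ t, Tendsto (fun k => f (t + (α (φ (ψ k)) + β (φ (ψ k))))) atTop (𝓝 (h t)) :=
      fun t => hh.tendsto_at t
    refine ⟨φ ∘ ψ, hφ.comp hψ, h, g, h1,
      fun t => (hg.tendsto_at t).comp hψ.tendsto_atTop, fun t => ?_⟩
    refine (tendsto_iff_of_dist ?_).1 (h1 t)
    rw [Metric.tendsto_nhds]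
    intro ε hε
    filter_upwards [hψ.tendsto_atTop.eventually (Metric.tendstoUniformly_iff.1 hg ε hε)] with k hk
    have := hk (t + α (φ (ψ k)))
    rw [Real.dist_0_eq_abs, abs_of_nonneg dist_nonneg, dist_comm]
    simpa [add_assoc] using this
  · intro H ε hε
    by_cases hfin : ∃ s : Finset ℝ, ∀ a, ∃ x ∈ s, ∀ t, dist (f (t + (a - x))) (f t) < ε
    · obtain ⟨s, hs⟩ := hfin
      obtain ⟨B, hB⟩ := s.finite_toSet.isBounded.exists_norm_le
      have hB' : ∀ x ∈ s, |x| ≤ B := fun x hx => hB x hx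
      refine ⟨2 * (|B| + 1), by positivity, fun a => ?_⟩
      obtain ⟨x, hx, hxd⟩ := hs (a + (|B| + 1))
      have h1 := abs_le.1 ((hB' x hx).trans (le_abs_self B))
      exact ⟨_, ⟨by linarith, by linarith⟩, hxd⟩
    · exfalso
      push Not at hfin
      obtain ⟨α, -, hα⟩ := exists_seq_of_forall_finset_exists (fun _ : ℝ => True)
        (fun x y => ∃ t, ε ≤ dist (f (t + (y - x))) (f t))
        (fun s _ => by
          obtain ⟨a, ha⟩ := hfin s
          exact ⟨a, trivial, ha⟩)
      obtain ⟨φ, hφ, -, g, -, hg, -⟩ := H (fun _ => 0) α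
      have ht : ∀ k, ∃ t, ε ≤ dist (f (t + α (φ (k + 1)))) (f (t + α (φ k))) := by
        intro k
        obtain ⟨t, ht⟩ := hα (φ k) (φ (k + 1)) (hφ (Nat.lt_succ_self k))
        refine ⟨t - α (φ k), ?_⟩
        convert ht using 3 <;> ring
      choose s hs using ht
      obtain ⟨ψ, hψ, h₁, g₁, ha, hb, hc⟩ := H s (fun k => α (φ k))
      obtain ⟨χ, hχ, h₂, g₂, ha', hb', hc'⟩ := H (s ∘ ψ) (fun k => α (φ (ψ k + 1)))
      have e1 : g₁ = g := funext fun t =>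
        tendsto_nhds_unique (hb t) ((hg t).comp hψ.tendsto_atTop)
      have e2 : g₂ = g := funext fun t =>
        tendsto_nhds_unique (hb' t) ((hg t).comp ((tendsto_add_atTop_nat 1).comp
          (hψ.tendsto_atTop.comp hχ.tendsto_atTop)))
      subst e1
      subst e2
      have e3 : h₁ 0 = h₂ 0 :=
        tendsto_nhds_unique ((hc 0).comp hχ.tendsto_atTop) (hc' 0)
      have hlim := (ha' 0).dist ((ha 0).comp hχ.tendsto_atTop)
      rw [e3, dist_self] at hlim
      have := ge_of_tendsto hlim (b := ε) (Eventually.of_forall fun k => by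
        simpa using hs (ψ (χ k)))
      linarith
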